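/- Let J∘ be an Inc(ℕ)-invariant ideal chain in R such that I(J∘) is bounded above. Then there is N ∈ ℕ such that for all n ≥ N and every Inc(ℕ)-compatible term order ⪯ on R, in_⪯(J_n) = Σ_{1 ≤ i₁ < ... < i_N ≤ n} ⟨in_⪯(J_n ∩ R_{{i₁,...,i_N}})⟩_{R_n}, where each intersection J_n ∩ R_{{i₁,...,i_N}} is regarded as an ideal of R_{{i₁,...,i_N}}. -/

import Mathlib

open MvPolynomial

/-- The ambient polynomial ring `R = K[x_{i,j} | i ∈ [c], j ∈ ℕ]`
(second variable indices are written `0`-based). -/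
abbrev PolyR (K : Type*) [Field K] (c : ℕ) : Type _ := MvPolynomial (Fin c × ℕ) K

/-- The action of `p : ℕ → ℕ` on variable indices: `x_{i,j} ↦ x_{i,p(j)}`. -/
def incVar (c : ℕ) (p : ℕ → ℕ) : Fin c × ℕ → Fin c × ℕ := fun v => (v.1, p v.2)

/-- The `K`-linear (in fact `K`-algebra) action of `p : ℕ → ℕ` on `R`. -/
noncomputable def incAct (K : Type*) [Field K] (c : ℕ) (p : ℕ → ℕ) :
    PolyR K c →ₐ[K] PolyR K c := rename (incVar c p)

/-- `Inc(ℕ)_{m,n}`: strictly increasing maps sending the first `m` variable indices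
into the first `n` variable indices. -/
def IncIn (m n : ℕ) : Set (ℕ → ℕ) := {p | StrictMono p ∧ ∀ j < m, p j < n}

/-- `R_A`: the polynomials using only variables `x_{i,j}` with `j ∈ A`. -/
def RsetOn (K : Type*) [Field K] (c : ℕ) (A : Set ℕ) : Set (PolyR K c) :=
  (supported K {v : Fin c × ℕ | v.2 ∈ A} : Subalgebra K (PolyR K c))

/-- `R_n`: the polynomials using only the first `n` variable indices. -/
def Rset (K : Type*) [Field K] (c n : ℕ) : Set (PolyR K c) := RsetOn K c {j | j < n}

/-- `J` is an ideal of the subring of `R` with underlying set `A`. -/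
def IsIdealOf {K : Type*} [Field K] {c : ℕ} (J A : Set (PolyR K c)) : Prop :=
  J ⊆ A ∧ (0 : PolyR K c) ∈ J ∧ (∀ f ∈ J, ∀ g ∈ J, f + g ∈ J) ∧
    ∀ a ∈ A, ∀ f ∈ J, a * f ∈ J

/-- The ideal of the subring of `R` with underlying set `A` generated by `S`. -/
def spanIn {K : Type*} [Field K] {c : ℕ} (A S : Set (PolyR K c)) : Set (PolyR K c) :=
  ⋂₀ {J : Set (PolyR K c) | IsIdealOf J A ∧ S ⊆ J}

/-- The set `Inc(ℕ)_{m,n} · S`. -/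
def incOrbit (K : Type*) [Field K] (c m n : ℕ) (S : Set (PolyR K c)) : Set (PolyR K c) :=
  {g | ∃ p ∈ IncIn m n, ∃ f ∈ S, g = incAct K c p f}

/-- An `Inc(ℕ)`-invariant ideal chain in `R`. -/
def IsIncChain (K : Type*) [Field K] (c : ℕ) (J : ℕ → Set (PolyR K c)) : Prop :=
  (∀ n, IsIdealOf (J n) (Rset K c n)) ∧
    ∀ m n, m ≤ n → incOrbit K c m n (J m) ⊆ J n

/-- The set of indices from which on the chain `J` is generated by `Inc(ℕ)`-shifts. -/
def stabSet (K : Type*) [Field K] (c : ℕ) (J : ℕ → Set (PolyR K c)) : Set ℕ :=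
  {N | ∀ n, N ≤ n → spanIn (Rset K c n) (incOrbit K c N n (J N)) = J n}

/-- The stability index `Ind(J∘)` of an ideal chain. -/
noncomputable def Ind (K : Type*) [Field K] (c : ℕ) (J : ℕ → Set (PolyR K c)) : ℕ :=
  sInf (stabSet K c J)

/-- A term order: a total order on monomials (identified with their exponent vectors,
so that multiplication of monomials becomes addition) which respects multiplication and
has the monomial `1` (exponent vector `0`) as least element. -/
structure TermOrder (σ : Type*) where
  le : (σ →₀ ℕ) → (σ →₀ ℕ) → Prop
  refl : ∀ a, le a a
  trans : ∀ a b c, le a b → le b c → le a c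
  antisymm : ∀ a b, le a b → le b a → a = b
  total : ∀ a b, le a b ∨ le b a
  add_right : ∀ a b h, le a b → le (a + h) (b + h)
  zero_le : ∀ a, le 0 a

/-- A term order on `R` is `Inc(ℕ)`-compatible if it is preserved by the action of every
strictly increasing map. -/
def IncCompatible (c : ℕ) (T : TermOrder (Fin c × ℕ)) : Prop :=
  ∀ p : ℕ → ℕ, StrictMono p → ∀ a b, T.le a b →
    T.le (Finsupp.mapDomain (incVar c p) a) (Finsupp.mapDomain (incVar c p) b)

/-- `a` is the exponent vector of the leading monomial of `f` with respect to `T`. -/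
def IsLeadMon {K : Type*} [Field K] {c : ℕ} (T : TermOrder (Fin c × ℕ))
    (f : PolyR K c) (a : (Fin c × ℕ) →₀ ℕ) : Prop :=
  a ∈ f.support ∧ ∀ b ∈ f.support, T.le b a

/-- The set of leading monomials of the nonzero elements of `J`. -/
def leadMonSet (K : Type*) [Field K] (c : ℕ) (T : TermOrder (Fin c × ℕ))
    (J : Set (PolyR K c)) : Set (PolyR K c) :=
  {g | ∃ f ∈ J, f ≠ 0 ∧ ∃ a, IsLeadMon T f a ∧ g = monomial a (1 : K)}

/-- The initial ideal of `J`, as an ideal of `R_A`. -/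
def initialOn (K : Type*) [Field K] (c : ℕ) (T : TermOrder (Fin c × ℕ)) (A : Set ℕ)
    (J : Set (PolyR K c)) : Set (PolyR K c) :=
  spanIn (RsetOn K c A) (leadMonSet K c T J)

/-- The chain of initial ideals `in_T(J_1) ⊆ in_T(J_2) ⊆ ...`. -/
def inChain (K : Type*) [Field K] (c : ℕ) (T : TermOrder (Fin c × ℕ))
    (J : ℕ → Set (PolyR K c)) : ℕ → Set (PolyR K c) :=
  fun n => initialOn K c T {j | j < n} (J n)

/-- `I(J∘)`: the set of stability indices of initial ideal chains of `J` with respect to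
`Inc(ℕ)`-compatible term orders. -/
def IndSet (K : Type*) [Field K] (c : ℕ) (J : ℕ → Set (PolyR K c)) : Set ℕ :=
  {N | ∃ T : TermOrder (Fin c × ℕ), IncCompatible c T ∧ Ind K c (inChain K c T J) = N}

/-- `S_n`: bijections of the variable indices fixing all indices outside the first `n`. -/
def SymN (n : ℕ) : Set (ℕ → ℕ) := {σ | Function.Bijective σ ∧ ∀ i, n ≤ i → σ i = i}

/-- An `S_∞`-invariant ideal chain in `R`. -/
def IsSymChain (K : Type*) [Field K] (c : ℕ) (J : ℕ → Set (PolyR K c)) : Prop :=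
  (∀ n, IsIdealOf (J n) (Rset K c n)) ∧
    ∀ m n, m ≤ n → ∀ σ ∈ SymN n, ∀ f ∈ J m, incAct K c σ f ∈ J n

section IncChains

variable {K : Type*} [Field K] {c : ℕ}

section RelativeIdeals

theorem subset_spanIn (A S : Set (PolyR K c)) : S ⊆ spanIn A S :=
  Set.subset_sInter fun _ h => h.2

theorem spanIn_subset {A S I : Set (PolyR K c)} (hI : IsIdealOf I A) (hS : S ⊆ I) :
    spanIn A S ⊆ I :=
  Set.sInter_subset_of_mem ⟨hI, hS⟩

theorem isIdealOf_RsetOn (A : Set ℕ) : IsIdealOf (RsetOn K c A) (RsetOn K c A) :=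
  ⟨subset_rfl, zero_mem (supported K _), fun _ hf _ hg => add_mem (S := Subalgebra K _) hf hg,
    fun _ ha _ hf => mul_mem (S := Subalgebra K _) ha hf⟩

theorem isIdealOf_spanIn {A : Set ℕ} {S : Set (PolyR K c)} (hS : S ⊆ RsetOn K c A) :
    IsIdealOf (spanIn (RsetOn K c A) S) (RsetOn K c A) :=
  ⟨spanIn_subset (isIdealOf_RsetOn A) hS, fun _ hI => hI.1.2.1,
    fun f hf g hg I hI => hI.1.2.2.1 f (hf I hI) g (hg I hI),
    fun a ha f hf I hI => hI.1.2.2.2 a ha f (hf I hI)⟩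

theorem RsetOn_mono {A B : Set ℕ} (h : A ⊆ B) : RsetOn K c A ⊆ RsetOn K c B :=
  supported_mono (R := K) fun _ hv => h hv

/-- Contracting an ideal of `R_B` along a homomorphism sending `R_A` to `R_B`. -/
theorem IsIdealOf.comap {A B : Set ℕ} {I : Set (PolyR K c)} (hI : IsIdealOf I (RsetOn K c B))
    (φ : PolyR K c →ₐ[K] PolyR K c) (hφ : ∀ f ∈ RsetOn K c A, φ f ∈ RsetOn K c B) :
    IsIdealOf {f | f ∈ RsetOn K c A ∧ φ f ∈ I} (RsetOn K c A) := by
  have hA := isIdealOf_RsetOn (K := K) (c := c) A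
  refine ⟨fun f hf => hf.1, ⟨hA.2.1, by simpa using hI.2.1⟩, ?_, ?_⟩
  · intro f hf g hg
    exact ⟨hA.2.2.1 f hf.1 g hg.1, by rw [map_add]; exact hI.2.2.1 _ hf.2 _ hg.2⟩
  · intro a ha f hf
    exact ⟨hA.2.2.2 a ha f hf.1, by rw [map_mul]; exact hI.2.2.2 _ (hφ a ha) _ hf.2⟩

end RelativeIdeals

section Exponents

theorem eq_zero_of_mem_support {A : Set ℕ} {f : PolyR K c} (hf : f ∈ RsetOn K c A)
    {a : (Fin c × ℕ) →₀ ℕ} (ha : a ∈ f.support) {v : Fin c × ℕ} (hv : v.2 ∉ A) : a v = 0 := by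
  by_contra h
  exact hv (mem_supported.1 hf ((mem_vars_iff_mem_support v).2 ⟨a, ha, Finsupp.mem_support_iff.2 h⟩))

theorem monomial_mem_RsetOn {A : Set ℕ} {a : (Fin c × ℕ) →₀ ℕ}
    (ha : ∀ v : Fin c × ℕ, v.2 ∉ A → a v = 0) : monomial a (1 : K) ∈ RsetOn K c A := by
  refine mem_supported.2 fun v hv => ?_
  rw [vars_monomial one_ne_zero] at hv
  by_contra h
  exact Finsupp.mem_support_iff.1 hv (ha v h)

theorem leadMonSet_subset_RsetOn (T : TermOrder (Fin c × ℕ)) {A : Set ℕ} {J : Set (PolyR K c)}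
    (hJ : J ⊆ RsetOn K c A) : leadMonSet K c T J ⊆ RsetOn K c A := by
  rintro _ ⟨f, hf, -, a, ha, rfl⟩
  exact monomial_mem_RsetOn fun v hv => eq_zero_of_mem_support (hJ hf) ha.1 hv

theorem isIdealOf_initialOn (T : TermOrder (Fin c × ℕ)) {A : Set ℕ} {J : Set (PolyR K c)}
    (hJ : J ⊆ RsetOn K c A) : IsIdealOf (initialOn K c T A J) (RsetOn K c A) :=
  isIdealOf_spanIn (leadMonSet_subset_RsetOn T hJ)

/-- Initial ideals are monotone in both the ideal and the ambient ring. -/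
theorem initialOn_mono (T : TermOrder (Fin c × ℕ)) {A B : Set ℕ} (hAB : A ⊆ B)
    {I J : Set (PolyR K c)} (hIA : I ⊆ RsetOn K c A) (hJB : J ⊆ RsetOn K c B) (hIJ : I ⊆ J) :
    initialOn K c T A I ⊆ initialOn K c T B J := by
  refine (spanIn_subset ((isIdealOf_initialOn T hJB).comap (AlgHom.id K _)
    fun f hf => RsetOn_mono hAB hf) fun g hg => ⟨leadMonSet_subset_RsetOn T hIA hg, ?_⟩).trans
    fun g hg => hg.2
  obtain ⟨f, hf, h⟩ := hg
  exact subset_spanIn _ _ ⟨f, hIJ hf, h⟩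

/-- An ideal containing a monomial contains its monomial multiples. -/
theorem IsIdealOf.monomial_mem_of_le {A : Set ℕ} {I : Set (PolyR K c)}
    (hI : IsIdealOf I (RsetOn K c A)) {a b : (Fin c × ℕ) →₀ ℕ} (hab : a ≤ b)
    (hb : ∀ v : Fin c × ℕ, v.2 ∉ A → b v = 0) (ha : monomial a (1 : K) ∈ I) :
    monomial b (1 : K) ∈ I := by
  have h := hI.2.2.2 (monomial (b - a) (1 : K))
    (monomial_mem_RsetOn fun v hv => by simp [hb v hv]) _ ha
  rwa [monomial_mul, one_mul, tsub_add_cancel_of_le hab] at h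

end Exponents

section Action

theorem incVar_injective {p : ℕ → ℕ} (hp : StrictMono p) :
    Function.Injective (incVar c p) := by
  rintro ⟨i, j⟩ ⟨i', j'⟩ h
  simp only [incVar, Prod.mk.injEq] at h
  rw [h.1, hp.injective h.2]

theorem incAct_mem_RsetOn {A B : Set ℕ} {p : ℕ → ℕ} (hp : Set.MapsTo p A B) {f : PolyR K c}
    (hf : f ∈ RsetOn K c A) : incAct K c p f ∈ RsetOn K c B := by
  classical
  refine mem_supported.2 fun v hv => ?_
  obtain ⟨u, hu, rfl⟩ := Finset.mem_image.1 (vars_rename (incVar c p) f hv)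
  exact hp (mem_supported.1 hf hu)

theorem IsLeadMon.incAct {T : TermOrder (Fin c × ℕ)} (hT : IncCompatible c T) {p : ℕ → ℕ}
    (hp : StrictMono p) {f : PolyR K c} {a : (Fin c × ℕ) →₀ ℕ} (ha : IsLeadMon T f a) :
    IsLeadMon T (incAct K c p f) (Finsupp.mapDomain (incVar c p) a) := by
  classical
  have hs : (_root_.incAct K c p f).support =
      Finset.image (Finsupp.mapDomain (incVar c p)) f.support :=
    support_rename_of_injective (incVar_injective hp)
  refine ⟨hs ▸ Finset.mem_image_of_mem _ ha.1, fun b hb => ?_⟩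
  rw [hs] at hb
  obtain ⟨d, hd, rfl⟩ := Finset.mem_image.1 hb
  exact hT p hp d a (ha.2 d hd)

theorem IsLeadMon.ne_zero {T : TermOrder (Fin c × ℕ)} {f : PolyR K c}
    {a : (Fin c × ℕ) →₀ ℕ} (ha : IsLeadMon T f a) : f ≠ 0 := by
  rintro rfl
  simpa using ha.1

/-- The leading monomials of an `Inc(ℕ)`-invariant chain are `Inc(ℕ)`-invariant. -/
theorem IsIncChain.incAct_leadMonSet {J : ℕ → Set (PolyR K c)} (hJ : IsIncChain K c J)
    {T : TermOrder (Fin c × ℕ)} (hT : IncCompatible c T) {m n : ℕ} (hmn : m ≤ n) {p : ℕ → ℕ}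
    (hp : p ∈ IncIn m n) {g : PolyR K c} (hg : g ∈ leadMonSet K c T (J m)) :
    incAct K c p g ∈ leadMonSet K c T (J n) := by
  obtain ⟨f, hf, -, a, ha, rfl⟩ := hg
  have ha' := ha.incAct hT hp.1
  exact ⟨incAct K c p f, hJ.2 m n hmn ⟨p, hp, f, hf, rfl⟩, ha'.ne_zero, _, ha',
    rename_monomial _ _ _⟩

theorem IsIncChain.isIncChain_inChain {J : ℕ → Set (PolyR K c)} (hJ : IsIncChain K c J)
    {T : TermOrder (Fin c × ℕ)} (hT : IncCompatible c T) :
    IsIncChain K c (inChain K c T J) := by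
  have hI : ∀ n, IsIdealOf (inChain K c T J n) (Rset K c n) := fun n =>
    isIdealOf_initialOn T (hJ.1 n).1
  refine ⟨hI, ?_⟩
  rintro m n hmn _ ⟨p, hp, f, hf, rfl⟩
  refine (spanIn_subset ((hI n).comap (incAct K c p)
    fun g hg => incAct_mem_RsetOn (fun j hj => hp.2 j hj) hg) (fun g hg => ?_) hf).2
  exact ⟨leadMonSet_subset_RsetOn T (hJ.1 m).1 hg,
    subset_spanIn _ _ (hJ.incAct_leadMonSet hT hmn hp hg)⟩

/-- Elements of `Inc(ℕ)_{m,n}` factor, on the first `m` indices, through every `N` in between. -/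
theorem exists_factor_of_mem_IncIn {m N n : ℕ} (hmN : m ≤ N) (hNn : N ≤ n) {p : ℕ → ℕ}
    (hp : p ∈ IncIn m n) :
    ∃ q ∈ IncIn m N, ∃ r ∈ IncIn N n, ∀ j < m, p j = r (q j) := by
  obtain ⟨hmono, hlt⟩ := hp
  refine ⟨fun j => min (p j) (N - m + j), ⟨fun a b hab => ?_, fun j hj => ?_⟩,
    fun k => if k < N - m then k else max k (p (k - (N - m))),
    ⟨fun a b hab => ?_, fun k hk => ?_⟩, fun j hj => ?_⟩
  · have := hmono hab
    grind
  · grind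
  · dsimp only
    split_ifs with h₁ h₂ h₂
    · exact hab
    · exact lt_of_lt_of_le hab (le_max_left _ _)
    · omega
    · exact max_lt_max hab (hmono (by omega))
  · dsimp only
    split_ifs with h
    · omega
    · exact max_lt (by omega) (hlt _ (by omega))
  · dsimp only
    rcases le_total (p j) (N - m + j) with h | h
    · rw [min_eq_left h]
      split_ifs with h'
      · rfl
      · exact (max_eq_left (hmono.monotone (by omega))).symm
    · rw [min_eq_right h, if_neg (by omega), Nat.add_sub_cancel_left, max_eq_right h]

theorem incAct_congr {m : ℕ} {p q : ℕ → ℕ} (h : ∀ j < m, p j = q j) {f : PolyR K c}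
    (hf : f ∈ Rset K c m) : incAct K c p f = incAct K c q f := by
  refine hom_congr_vars (f₁ := (incAct K c p).toRingHom) (f₂ := (incAct K c q).toRingHom)
    (by ext; simp [incAct]) (fun v hv _ => ?_) rfl
  have : v.2 < m := mem_supported.1 hf hv
  simp [incAct, incVar, h _ this]

theorem incAct_incAct (p q : ℕ → ℕ) (f : PolyR K c) :
    incAct K c p (incAct K c q f) = incAct K c (p ∘ q) f :=
  rename_rename _ _ f

end Action

section Noetherianity

/-- The columns of an exponent vector with respect to the first `n` variable indices. -/
def exponentColumns (n : ℕ) (a : (Fin c × ℕ) →₀ ℕ) : List (Fin c → ℕ) :=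
  (List.range n).map fun j i => a (i, j)

theorem getElem_exponentColumns {n : ℕ} {a : (Fin c × ℕ) →₀ ℕ} {j : ℕ}
    (hj : j < (exponentColumns n a).length) :
    (exponentColumns n a)[j] = fun i => a (i, j) := by
  simp [exponentColumns]

theorem exists_mapDomain_le_of_sublistForall₂ {m n : ℕ} {a b : (Fin c × ℕ) →₀ ℕ}
    (ha : ∀ v : Fin c × ℕ, ¬ v.2 < m → a v = 0)
    (h : List.SublistForall₂ (· ≤ ·) (exponentColumns m a) (exponentColumns n b)) :
    ∃ p ∈ IncIn m n, Finsupp.mapDomain (incVar c p) a ≤ b := by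
  obtain ⟨l, hl, hsub⟩ := List.sublistForall₂_iff.1 h
  obtain ⟨p, hp⟩ := List.sublist_iff_exists_orderEmbedding_getElem?_eq.1 hsub
  have hlen : l.length = m := by rw [← hl.length_eq]; simp [exponentColumns]
  have key : ∀ j < m, p j < n ∧ ∀ i, a (i, j) ≤ b (i, p j) := by
    intro j hj
    have hjl : j < l.length := by omega
    have h₁ := hp j
    rw [List.getElem?_eq_getElem hjl] at h₁
    obtain ⟨hpj, h₂⟩ := List.getElem?_eq_some_iff.1 h₁.symm
    have h₃ := hl.get (i := j) (by simpa [exponentColumns] using hj) hjl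
    have hpn : p j < n := by simpa [exponentColumns] using hpj
    refine ⟨hpn, fun i => ?_⟩
    have h₄ := h₃ i
    rw [List.get_eq_getElem, List.get_eq_getElem] at h₄
    simpa only [← h₂, getElem_exponentColumns] using h₄
  refine ⟨p, ⟨p.strictMono, fun j hj => (key j hj).1⟩, fun v => ?_⟩
  by_cases hv : v ∈ Set.range (incVar c p)
  · obtain ⟨u, rfl⟩ := hv
    rw [Finsupp.mapDomain_apply (incVar_injective p.strictMono)]
    by_cases hu : u.2 < m
    · exact (key u.2 hu).2 u.1
    · simp [ha u hu]
  · simp [Finsupp.mapDomain_of_notMem_range _ _ hv]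

/-- Initial chains of `Inc(ℕ)`-invariant chains stabilize (a consequence of Higman's lemma). -/
theorem IsIncChain.stabSet_inChain_nonempty {J : ℕ → Set (PolyR K c)} (hJ : IsIncChain K c J)
    {T : TermOrder (Fin c × ℕ)} (hT : IncCompatible c T) :
    (stabSet K c (inChain K c T J)).Nonempty := by
  have hM := hJ.isIncChain_inChain hT
  suffices ∃ N, ∀ n, N ≤ n → ∀ b, monomial b (1 : K) ∈ leadMonSet K c T (J n) →
      monomial b (1 : K) ∈ spanIn (Rset K c n) (incOrbit K c N n (leadMonSet K c T (J N))) by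
    obtain ⟨N, hN⟩ := this
    refine ⟨N, fun n hn => Set.Subset.antisymm
      (spanIn_subset (hM.1 n) (hM.2 N n hn)) (spanIn_subset
        (isIdealOf_spanIn ((hM.2 N n hn).trans (hM.1 n).1)) fun g hg => ?_)⟩
    obtain ⟨f, hf, hf₀, b, hb, rfl⟩ := hg
    rintro I ⟨hI, hsub⟩
    refine hN n hn b ⟨f, hf, hf₀, b, hb, rfl⟩ I ⟨hI, ?_⟩
    rintro _ ⟨p, hp, g, hg, rfl⟩
    exact hsub ⟨p, hp, g, subset_spanIn _ _ hg, rfl⟩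
  by_contra! hbad
  choose F hF b hb hnot using hbad
  have hsupp : ∀ N (v : Fin c × ℕ), v.2 ∉ {j | j < F N} → b N v = 0 := by
    intro N v hv
    have := leadMonSet_subset_RsetOn T (hJ.1 (F N)).1 (hb N)
    exact eq_zero_of_mem_support this (by simp [mem_support_iff]) hv
  have hmono : Monotone fun k => F^[k] 0 :=
    monotone_nat_of_le_succ fun k => by
      rw [Function.iterate_succ_apply']
      exact hF _
  have hpwo : (Set.univ : Set (Fin c → ℕ)).PartiallyWellOrderedOn (· ≤ ·) :=
    Set.isPWO_of_wellQuasiOrderedLE _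
  obtain ⟨k, l, hkl, hsub⟩ := (hpwo.partiallyWellOrderedOn_sublistForall₂ (· ≤ ·)).exists_lt
    (f := fun k => exponentColumns (F (F^[k] 0)) (b (F^[k] 0))) (fun k x _ => Set.mem_univ x)
  obtain ⟨p, hp, hle⟩ := exists_mapDomain_le_of_sublistForall₂ (hsupp _) hsub
  have hkl' : F (F^[k] 0) ≤ F^[l] 0 := by
    rw [← Function.iterate_succ_apply' F k 0]
    exact hmono hkl
  obtain ⟨q, hq, r, hr, hpqr⟩ := exists_factor_of_mem_IncIn hkl' (hF _) hp
  refine hnot (F^[l] 0) ?_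
  rintro I ⟨hI, hI'⟩
  refine hI.monomial_mem_of_le hle (hsupp _)
    (hI' ⟨r, hr, _, hJ.incAct_leadMonSet hT hkl' hq (hb _), ?_⟩)
  rw [incAct_incAct, ← incAct_congr (p := p) (q := r ∘ q) (m := F (F^[k] 0)) hpqr
    (leadMonSet_subset_RsetOn T (hJ.1 _).1 (hb _))]
  exact (rename_monomial _ _ _).symm

end Noetherianity

end IncChains

/-- **Theorem (Statement 11).** Let `J∘` be an `Inc(ℕ)`-invariant ideal chain in `R` such that
`I(J∘)` is bounded above. Then there is `N ∈ ℕ` such that for all `n ≥ N` and every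
`Inc(ℕ)`-compatible term order `⪯` on `R`,
`in_⪯(J_n) = Σ_{1 ≤ i₁ < ... < i_N ≤ n} ⟨in_⪯(J_n ∩ R_{{i₁,...,i_N}})⟩_{R_n}`,
where each intersection is regarded as an ideal of `R_{{i₁,...,i_N}}`. -/
theorem inChain_eq_sum_initial_of_intersections (K : Type*) [Field K] (c : ℕ) (hc : 0 < c)
    (J : ℕ → Set (PolyR K c)) (hJ : IsIncChain K c J)
    (hbdd : BddAbove (IndSet K c J)) :
    ∃ N : ℕ, ∀ n, N ≤ n → ∀ T : TermOrder (Fin c × ℕ), IncCompatible c T →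
      inChain K c T J n =
        spanIn (Rset K c n)
          (⋃ i ∈ {i : Fin N → ℕ | StrictMono i ∧ ∀ r, i r < n},
            initialOn K c T (Set.range i) (J n ∩ RsetOn K c (Set.range i))) := by
  obtain ⟨B, hB⟩ := hbdd
  refine ⟨B, fun n hn T hT => ?_⟩
  have hInd : Ind K c (inChain K c T J) ≤ B := hB ⟨T, hT, rfl⟩
  have hstab := Nat.sInf_mem (hJ.stabSet_inChain_nonempty hT)
  change Ind K c (inChain K c T J) ∈ _ at hstab
  generalize Ind K c (inChain K c T J) = m at hInd hstab
  have hU : (⋃ i ∈ {i : Fin B → ℕ | StrictMono i ∧ ∀ r, i r < n},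
      initialOn K c T (Set.range i) (J n ∩ RsetOn K c (Set.range i))) ⊆ inChain K c T J n := by
    refine Set.iUnion₂_subset fun i hi => initialOn_mono T ?_ Set.inter_subset_right (hJ.1 n).1
      Set.inter_subset_left
    rintro _ ⟨r, rfl⟩
    exact hi.2 r
  have hI := (hJ.isIncChain_inChain hT).1 n
  have hS := isIdealOf_spanIn (hU.trans hI.1)
  refine Set.Subset.antisymm ?_ (spanIn_subset hI hU)
  rw [← hstab n (hInd.trans hn)]
  refine spanIn_subset hS ?_
  rintro _ ⟨p, hp, f, hf, rfl⟩
  refine (spanIn_subset (hS.comap (incAct K c p)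
    fun g hg => incAct_mem_RsetOn (fun j hj => hp.2 j hj) hg) (fun g hg => ?_) hf).2
  refine ⟨leadMonSet_subset_RsetOn T (hJ.1 m).1 hg, subset_spanIn _ _ ?_⟩
  obtain ⟨f, hf, -, a, ha, rfl⟩ := hg
  obtain ⟨q, hq, r, hr, hpqr⟩ := exists_factor_of_mem_IncIn hInd hn hp
  have ha' := ha.incAct hT hp.1
  refine Set.mem_iUnion₂.2 ⟨fun j : Fin B => r j, ⟨fun x y hxy => hr.1 hxy, fun j => hr.2 j j.2⟩,
    subset_spanIn _ _ ⟨incAct K c p f, ⟨hJ.2 m n (hInd.trans hn) ⟨p, hp, f, hf, rfl⟩, ?_⟩,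
      ha'.ne_zero, _, ha', rename_monomial _ _ _⟩⟩
  refine incAct_mem_RsetOn (A := {j | j < m}) (fun j hj => ?_) ((hJ.1 m).1 hf)
  exact ⟨⟨q j, hq.2 j hj⟩, (hpqr j hj).symm⟩
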